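/- In a quasitriangular Hopf algebra A with R-matrix ρ = Σ e⊗e', for all a ∈ A: Σ e ⊗ e'a = Σ a₃es⁻¹(a₁) ⊗ a₂e'. -/

import Mathlib

open scoped TensorProduct
open Coalgebra HopfAlgebra

/-- The bilinear map `(x, y ⊗ z) ↦ (z ⊗ y) ρ (f x ⊗ 1)`. -/
noncomputable def swapMulLeft {k A : Type*} [CommSemiring k] [Semiring A] [Algebra k A]
    (f : A →ₗ[k] A) (ρ : A ⊗[k] A) : A →ₗ[k] A ⊗[k] A →ₗ[k] A ⊗[k] A :=
  LinearMap.mk₂ k (fun x t => TensorProduct.comm k A A t * ρ * (f x ⊗ₜ[k] 1))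
    (by simp [TensorProduct.add_tmul, mul_add])
    (by simp [← TensorProduct.smul_tmul'])
    (by simp [add_mul])
    (by simp)

/-- The bilinear map `(x, t) ↦ t (f x ⊗ 1)`. -/
noncomputable def mulLeftFactor {k A : Type*} [CommSemiring k] [Semiring A] [Algebra k A]
    (f : A →ₗ[k] A) : A →ₗ[k] A ⊗[k] A →ₗ[k] A ⊗[k] A :=
  LinearMap.mk₂ k (fun x t => t * (f x ⊗ₜ[k] 1))
    (by simp [TensorProduct.add_tmul, mul_add])
    (by simp [← TensorProduct.smul_tmul'])
    (by simp [add_mul])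
    (by simp)

/-- The inverse antipode satisfies `∑ a₂ s⁻¹(a₁) = ε(a)`. -/
theorem sum_mul_antipode_inv_eq_smul {R A ι : Type*} [CommSemiring R] [Semiring A]
    [HopfAlgebra R A] {a : A} (r : Coalgebra.Repr R a ι) (sInv : A → A)
    (hl : Function.LeftInverse sInv (antipode R))
    (hr : Function.RightInverse sInv (antipode R)) :
    ∑ i ∈ r.index, r.right i * sInv (r.left i) = counit (R := R) a • 1 := by
  apply hl.injective
  simp [antipode_mul_antidistrib, hr _, sum_mul_antipode_eq_smul]

/-- If `ρ Δ(x) = Δᵒᵖ(x) ρ` for all `x`, then `∑ (a₃ ⊗ a₂) ρ (s⁻¹(a₁) ⊗ 1) = ρ (1 ⊗ a)`. -/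
theorem lift_swapMulLeft_lTensor_comul {R A : Type*} [CommSemiring R] [Semiring A]
    [HopfAlgebra R A] (ρ : A ⊗[R] A)
    (hρ : ∀ x : A, ρ * comul x = TensorProduct.comm R A A (comul x) * ρ)
    (sInv : A →ₗ[R] A)
    (hl : Function.LeftInverse sInv (antipode R))
    (hr : Function.RightInverse sInv (antipode R)) (a : A) :
    TensorProduct.lift (swapMulLeft sInv ρ) (comul.lTensor A (comul a)) = ρ * (1 ⊗ₜ[R] a) := by
  have hswap (t : A ⊗[R] A) : TensorProduct.lift (swapMulLeft sInv ρ) (comul.lTensor A t) =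
      ρ * TensorProduct.lift (mulLeftFactor sInv) (comul.lTensor A t) := by
    induction t with
    | zero => simp
    | add x y hx hy => simp only [map_add, mul_add, hx, hy]
    | tmul x y => simp [swapMulLeft, mulLeftFactor, ← mul_assoc, hρ]
  have hcancel (x y : A) : TensorProduct.lift (mulLeftFactor sInv)
      (TensorProduct.assoc R A A A (comul x ⊗ₜ y)) = (counit (R := R) x • 1) ⊗ₜ y := by
    rw [← sum_mul_antipode_inv_eq_smul (ℛ R x) sInv hl hr, ← (ℛ R x).eq]
    simp [TensorProduct.sum_tmul, mulLeftFactor]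
  rw [hswap, ← coassoc_apply, ← (ℛ R a).eq]
  simp only [map_sum, LinearMap.rTensor_tmul, hcancel, TensorProduct.smul_tmul]
  rw [← TensorProduct.tmul_sum, sum_counit_smul]

/-- Bead push identity 4: `∑ e ⊗ e' a = ∑ a₃ e s⁻¹(a₁) ⊗ a₂ e'`. -/
theorem bead_push_four
    {k : Type*} [Field k] {A : Type*} [Ring A] [HopfAlgebra k A]
    {ι : Type*} [Fintype ι] (e e' : ι → A)
    (ρ : A ⊗[k] A) (hρ : ρ = ∑ j, e j ⊗ₜ[k] e' j)
    -- intertwining: ρ Δ(x) = Δᵒᵖ(x) ρ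
    (h1 : ∀ x : A, ρ * Coalgebra.comul x
        = (TensorProduct.comm k A A) (Coalgebra.comul x) * ρ)
    (a : A) {κ : Type*} [Fintype κ] (a1 a2 a3 : κ → A)
    -- Δ²(a) = ∑ i, a₁ ⊗ a₂ ⊗ a₃
    (ha : (TensorProduct.map (Coalgebra.comul (R := k)) LinearMap.id) (Coalgebra.comul a)
        = ∑ i, (a1 i ⊗ₜ[k] a2 i) ⊗ₜ[k] a3 i)
    (sInv : A →ₗ[k] A)
    (hsInv : ∀ x : A, sInv (HopfAlgebra.antipode (R := k) x) = x)
    (hsInv' : ∀ x : A, HopfAlgebra.antipode (R := k) (sInv x) = x) :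
    ∑ j, e j ⊗ₜ[k] (e' j * a)
      = ∑ i, ∑ j, (a3 i * e j * sInv (a1 i)) ⊗ₜ[k] (a2 i * e' j) := by
  have h := lift_swapMulLeft_lTensor_comul ρ h1 sInv hsInv hsInv' a
  rw [← coassoc_apply, LinearMap.rTensor, ha] at h
  simpa [hρ, swapMulLeft, Finset.sum_mul, Finset.mul_sum] using h.symm
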